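/- arXiv:2207.14283 — 2 statements merged into one kernel-verified Lean document; each statement's English description precedes it below -/
import Mathlib

section
/- Let R be a ring and let r be a central element of R with r^i = 0 for a positive integer i and j • r = 0 for a positive integer j (i.e., r is nilpotent of index at most i and has additive order dividing j). Then, setting n = (i - 1)! · j, one has (x + r)^n = x^n for all x in R. -/
/-- Power map for positive exponents in a (possibly nonunital) ring:
`nupow x n = x^n` for `n ≥ 1` (with junk value `0` at `n = 0`). -/
def nupow {R : Type*} [NonUnitalRing R] (x : R) : ℕ → R
  | 0 => 0
  | 1 => x
  | n + 2 => nupow x (n + 1) * x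

theorem Unitization.inr_nupow {R : Type*} [NonUnitalRing R] (x : R) {n : ℕ} (hn : 0 < n) :
    (Unitization.inr (nupow x n) : Unitization ℤ R) = (Unitization.inr x) ^ n := by
  induction n, hn using Nat.le_induction with
  | base => simp [nupow]
  | succ n hn ih =>
    obtain ⟨m, rfl⟩ := Nat.exists_eq_add_of_le' hn
    rw [nupow, Unitization.inr_mul, ih, pow_succ _ (m + 1)]

theorem Nat.dvd_choose_factorial_mul {i j k : ℕ} (hk : 0 < k) (hki : k < i) (hj : 0 < j) :
    j ∣ ((i - 1).factorial * j).choose k := by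
  obtain ⟨c, hc⟩ := Nat.dvd_factorial hk (Nat.le_sub_one_of_lt hki)
  have hn : 0 < (i - 1).factorial * j := Nat.mul_pos (Nat.factorial_pos _) hj
  obtain ⟨l, rfl⟩ := Nat.exists_eq_add_of_le' hk
  obtain ⟨m, hm⟩ := Nat.exists_eq_add_of_le' hn
  have h := Nat.add_one_mul_choose_eq m l
  refine ⟨c * m.choose l, Nat.eq_of_mul_eq_mul_right hk ?_⟩
  rw [hm, ← h, ← hm, hc]
  ring

theorem Commute.add_pow_factorial_mul_eq {S : Type*} [Ring S] {x r : S} (hxr : Commute r x)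
    {i j : ℕ} (hj : 0 < j) (hri : r ^ i = 0) (hrj : j • r = 0) :
    (x + r) ^ ((i - 1).factorial * j) = x ^ ((i - 1).factorial * j) := by
  rw [add_comm, hxr.add_pow, Finset.sum_eq_single 0]
  · simp
  · intro k _ hk
    rcases lt_or_ge k i with hki | hik
    · obtain ⟨d, hd⟩ := Nat.dvd_choose_factorial_mul (Nat.pos_of_ne_zero hk) hki hj
      obtain ⟨l, rfl⟩ := Nat.exists_eq_succ_of_ne_zero hk
      rw [← nsmul_eq_mul', hd, mul_comm j, mul_nsmul', ← smul_mul_assoc, pow_succ',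
        ← smul_mul_assoc j, hrj]
      simp
    · simp [pow_eq_zero_of_le hik hri]
  · simp

/-- If `r` is a central element of a (not necessarily commutative or unital) ring `R`
with `r^i = 0` and `j • r = 0` for positive integers `i`, `j`, then with
`n = (i-1)! * j` one has `(x + r)^n = x^n` for all `x ∈ R`. -/
theorem stmt1 {R : Type*} [NonUnitalRing R] (r : R)
    (hc : ∀ x : R, r * x = x * r) (i j : ℕ) (hi : 0 < i) (hj : 0 < j)
    (hri : nupow r i = 0) (hrj : j • r = 0) :
    ∀ x : R, nupow (x + r) ((i - 1).factorial * j) = nupow x ((i - 1).factorial * j) := by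
  intro x
  have hn : 0 < (i - 1).factorial * j := Nat.mul_pos (Nat.factorial_pos _) hj
  apply Unitization.inr_injective (R := ℤ)
  rw [Unitization.inr_nupow _ hn, Unitization.inr_nupow _ hn, Unitization.inr_add]
  refine Commute.add_pow_factorial_mul_eq (S := Unitization ℤ R) ?_ hj ?_ ?_
  · rw [Commute, SemiconjBy, ← Unitization.inr_mul, ← Unitization.inr_mul, hc]
  · rw [← Unitization.inr_nupow _ hi, hri, Unitization.inr_zero]
  · rw [← Unitization.inr_smul, hrj, Unitization.inr_zero]
end

section
/- Let R be a weakly periodic ring such that x·r = 0 and r·x = 0 for every x in R and every nilpotent element r of R (i.e., R annihilates Nil(R) on both sides). Then R is a commutative periodic ring: the multiplication of R is commutative and for every x in R there exist positive integers m and n with x^{m+n} = x^m. -/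
theorem mul_comm_of_idempotent_of_sq_zero {R : Type*} [NonUnitalRing R] {e : R} (he : e * e = e)
    (h : ∀ z : R, z * z = 0 → e * z = 0 ∧ z * e = 0) (x : R) : e * x = x * e := by
  have hl : e * (e * x - e * x * e) = 0 := by
    refine (h _ ?_).1
    have h1 : e * (e * x - e * x * e) = e * x - e * x * e := by
      rw [mul_sub, ← mul_assoc, ← mul_assoc, ← mul_assoc, he]
    have h2 : (e * x - e * x * e) * e = 0 := by
      rw [sub_mul, mul_assoc _ e e, he, sub_self]
    rw [← h1, ← mul_assoc, h1, h2, zero_mul]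
  have hr : (x * e - e * x * e) * e = 0 := by
    refine (h _ ?_).2
    have h1 : (x * e - e * x * e) * e = x * e - e * x * e := by
      rw [sub_mul, mul_assoc _ e e, mul_assoc _ e e, he]
    have h2 : e * (x * e - e * x * e) = 0 := by
      rw [mul_sub, ← mul_assoc, ← mul_assoc, ← mul_assoc, he, sub_self]
    rw [← h1, mul_assoc, h1, h2, mul_zero]
  rw [mul_sub, ← mul_assoc, ← mul_assoc, ← mul_assoc, he, sub_eq_zero] at hl
  rw [sub_mul, mul_assoc x, mul_assoc _ e e, he, sub_eq_zero] at hr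
  rw [hl, hr]

/-- If a potent element `x` normalizes the image of a finite ring `K`, then `x` and the image of
`K` generate a finite subring. -/
theorem finite_closure_insert_range {K D : Type*} [Ring K] [Finite K] [Ring D] (f : K →+* D)
    {x : D} {n : ℕ} (hn : 1 < n) (hx : x ^ n = x) (hnorm : ∀ c, ∃ c', x * f c = f c' * x) :
    Finite (Subring.closure (insert x (Set.range f))) := by
  let g : (Fin n → K) →+ D :=
    { toFun := fun c => ∑ j, f (c j) * x ^ (j : ℕ)
      map_zero' := by simp
      map_add' := fun c d => by simp [add_mul, Finset.sum_add_distrib] }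
  have hmono : ∀ (c : K) (j : ℕ), f c * x ^ j ∈ g.range := by
    intro c j
    induction j using Nat.strong_induction_on with
    | _ j ih =>
      by_cases hj : j < n
      · refine ⟨Pi.single ⟨j, hj⟩ c, ?_⟩
        change ∑ i : Fin n, f (Pi.single (M := fun _ => K) ⟨j, hj⟩ c i) * x ^ (i : ℕ) = _
        rw [Finset.sum_eq_single ⟨j, hj⟩]
        · simp
        · intro i _ hi
          simp [Pi.single_eq_of_ne hi]
        · simp
      · obtain ⟨k, rfl⟩ := Nat.exists_eq_add_of_le (not_lt.mp hj)
        rw [pow_add, hx, ← pow_succ']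
        exact ih (k + 1) (by omega)
  have hmul : ∀ a ∈ Subring.closure (insert x (Set.range f)), ∀ t ∈ g.range, a * t ∈ g.range := by
    intro a ha
    induction ha using Subring.closure_induction with
    | mem a ha =>
      rintro _ ⟨c, rfl⟩
      change a * ∑ j : Fin n, f (c j) * x ^ (j : ℕ) ∈ _
      rw [Finset.mul_sum]
      refine sum_mem fun j _ => ?_
      rcases ha with rfl | ⟨d, rfl⟩
      · obtain ⟨c', hc'⟩ := hnorm (c j)
        rw [← mul_assoc, hc', mul_assoc, ← pow_succ']
        exact hmono _ _
      · rw [← mul_assoc, ← map_mul]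
        exact hmono _ _
    | zero => intro t _; simp [g.range.zero_mem]
    | one => intro t ht; simpa using ht
    | add a b _ _ iha ihb => intro t ht; rw [add_mul]; exact add_mem (iha t ht) (ihb t ht)
    | neg a _ iha => intro t ht; rw [neg_mul]; exact neg_mem (iha t ht)
    | mul a b _ _ iha ihb => intro t ht; rw [mul_assoc]; exact iha _ (ihb t ht)
  have hone : (1 : D) ∈ g.range := by simpa using hmono 1 0
  have hfin : (g.range : Set D).Finite := Set.finite_range g
  refine (hfin.subset fun a ha => ?_).to_subtype
  simpa using hmul a ha 1 hone

open Polynomial in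
theorem prod_X_sub_C_eq_X_pow_card_sub_X (K : Type*) [Field K] [Fintype K] :
    ∏ l : K, (X - C l) = X ^ Fintype.card K - X := by
  have hroots := FiniteField.roots_X_pow_card_sub_X K
  have hmonic : (X ^ Fintype.card K - X : K[X]).Monic :=
    monic_X_pow_sub (by rw [degree_X]; exact_mod_cast Fintype.one_lt_card)
  rw [← prod_multiset_X_sub_C_of_monic_of_roots_card_eq hmonic, hroots]
  · rfl
  · rw [hroots, FiniteField.X_pow_card_sub_X_natDegree_eq K Fintype.one_lt_card]
    rfl

open Polynomial in
/-- If a finite subfield `K` of a domain contains a noncentral element `a`, then the inner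
derivation by `a` has a nonzero eigenvalue in `K`. -/
theorem exists_eigenvector_of_not_central {K D : Type*} [Field K] [Finite K] [Ring D]
    (f : K →+* D) (a : K) (y : D) (hy : f a * y ≠ y * f a) :
    ∃ (l : K) (x : D), l ≠ 0 ∧ x ≠ 0 ∧ f a * x - x * f a = f l * x := by
  classical
  cases nonempty_fintype K
  let _ : Module K D := Module.compHom D f
  have hsmul : ∀ (c : K) (d : D), c • d = f c * d := fun _ _ => rfl
  let r : Module.End K D :=
    { toFun := fun d => d * f a
      map_add' := fun d e => add_mul _ _ _
      map_smul' := fun c d => by simp [hsmul, mul_assoc] }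
  have hr : ∀ (k : ℕ) (d : D), (r ^ k) d = d * f a ^ k := by
    intro k
    induction k with
    | zero => simp
    | succ k ih => intro d; rw [pow_succ, Module.End.mul_apply, ih, pow_succ', ← mul_assoc]; rfl
  let δ : Module.End K D := algebraMap K _ a - r
  have hδ : ∀ d, δ d = f a * d - d * f a := fun d => rfl
  have hδpow : δ ^ Fintype.card K = δ := by
    obtain ⟨p, hp⟩ := CharP.exists K
    obtain ⟨k, hprime, hcard⟩ := FiniteField.card K p
    have : Fact p.Prime := ⟨hprime⟩
    have : Nontrivial D := ⟨_, _, hy⟩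
    have : Nontrivial (Module.End K D) := by
      refine ⟨1, 0, fun h => one_ne_zero (α := D) ?_⟩
      simpa using LinearMap.congr_fun h 1
    have : CharP (Module.End K D) p :=
      charP_of_injective_algebraMap (algebraMap K (Module.End K D)).injective p
    have h1 : δ ^ Fintype.card K
        = algebraMap K (Module.End K D) a ^ Fintype.card K - r ^ Fintype.card K := by
      rw [hcard]
      exact sub_pow_char_pow_of_commute p _ (Algebra.commutes a r)
    rw [h1, ← map_pow, FiniteField.pow_card]
    congr 1
    ext d
    rw [hr, ← map_pow, FiniteField.pow_card]
    rfl
  by_contra! hcon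
  have hinj : ∀ l : K, l ≠ 0 → Function.Injective (aeval δ (X - C l)) := by
    intro l hl
    rw [injective_iff_map_eq_zero]
    intro x hx
    by_contra hx0
    refine hcon l x hl hx0 ?_
    rw [← sub_eq_zero, ← hδ, ← hsmul]
    simpa using hx
  have hprod : ∀ s : Finset K, 0 ∉ s → Function.Injective (aeval δ (∏ l ∈ s, (X - C l))) := by
    intro s
    induction s using Finset.induction_on with
    | empty => intro _; simpa [Module.End.one_eq_id] using Function.injective_id
    | insert l s hl ih =>
      intro h0
      rw [Finset.prod_insert hl, map_mul, Module.End.coe_mul]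
      simp only [Finset.mem_insert, not_or] at h0
      exact (hinj l (Ne.symm h0.1)).comp (ih h0.2)
  have hpoly : (X ^ Fintype.card K - X : K[X]) = (∏ l ∈ Finset.univ.erase 0, (X - C l)) * X := by
    rw [← prod_X_sub_C_eq_X_pow_card_sub_X, ← Finset.prod_erase_mul _ _ (Finset.mem_univ (0 : K))]
    simp
  have hzero : aeval δ (X ^ Fintype.card K - X : K[X]) = 0 := by simp [hδpow]
  rw [hpoly, map_mul, aeval_X] at hzero
  have h2 := LinearMap.congr_fun hzero y
  rw [Module.End.mul_apply, LinearMap.zero_apply] at h2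
  have h3 := (injective_iff_map_eq_zero _).mp (hprod (Finset.univ.erase 0) (by simp)) _ h2
  exact hy (sub_eq_zero.mp h3)

theorem IsDomain.mul_comm_of_potent {D : Type*} [Ring D] [IsDomain D]
    (h : ∀ x : D, ∃ n : ℕ, 1 < n ∧ x ^ n = x) (a y : D) : a * y = y * a := by
  by_contra hay
  obtain ⟨p, hp⟩ := CharP.exists D
  have hp0 : p ≠ 0 := by
    rintro rfl
    have := CharP.charP_to_charZero D
    obtain ⟨n, hn, h2⟩ := h 2
    have : 2 ^ n = 2 := by exact_mod_cast h2
    have := Nat.pow_lt_pow_right (a := 2) one_lt_two hn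
    omega
  have : NeZero p := ⟨hp0⟩
  have hfin : Finite (Subring.closure (insert a (Set.range (ZMod.castHom (dvd_refl p) D)))) := by
    obtain ⟨n, hn, hx⟩ := h a
    exact finite_closure_insert_range _ hn hx fun c => ⟨c, by
      obtain ⟨k, rfl⟩ := ZMod.natCast_zmod_surjective c
      simp [Nat.cast_comm]⟩
  set P := Subring.closure (insert a (Set.range (ZMod.castHom (dvd_refl p) D))) with hP
  let _ : Field P := (Finite.isDomain_to_isField P).toField
  have haP : a ∈ P := Subring.subset_closure (Set.mem_insert _ _)
  obtain ⟨l, x, hl, hx, hlx⟩ := exists_eigenvector_of_not_central P.subtype ⟨a, haP⟩ y hay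
  change a * x - x * a = l * x at hlx
  have hnorm : ∀ c : P, ∃ c' : P, x * P.subtype c = P.subtype c' * x := by
    rintro ⟨c, hc⟩
    suffices ∃ c' ∈ P, x * c = c' * x by
      obtain ⟨c', hc', h⟩ := this
      exact ⟨⟨c', hc'⟩, h⟩
    rw [hP] at hc
    induction hc using Subring.closure_induction with
    | mem c hc =>
      rcases hc with rfl | ⟨k, rfl⟩
      · refine ⟨c - l, sub_mem haP l.2, ?_⟩
        rw [sub_mul, ← hlx, sub_sub_cancel]
      · refine ⟨_, Subring.subset_closure (Set.mem_insert_of_mem _ ⟨k, rfl⟩), ?_⟩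
        obtain ⟨k, rfl⟩ := ZMod.natCast_zmod_surjective k
        simp [Nat.cast_comm]
    | zero => exact ⟨0, zero_mem _, by simp⟩
    | one => exact ⟨1, one_mem _, by simp⟩
    | add c d _ _ ihc ihd =>
      obtain ⟨c', hc', hc⟩ := ihc
      obtain ⟨d', hd', hd⟩ := ihd
      exact ⟨c' + d', add_mem hc' hd', by rw [mul_add, add_mul, hc, hd]⟩
    | neg c _ ihc =>
      obtain ⟨c', hc', hc⟩ := ihc
      exact ⟨-c', neg_mem hc', by rw [mul_neg, neg_mul, hc]⟩
    | mul c d _ _ ihc ihd =>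
      obtain ⟨c', hc', hc⟩ := ihc
      obtain ⟨d', hd', hd⟩ := ihd
      exact ⟨c' * d', mul_mem hc' hd', by rw [← mul_assoc, hc, mul_assoc, hd, mul_assoc]⟩
  obtain ⟨n, hn, hxn⟩ := h x
  have hfin' := finite_closure_insert_range P.subtype hn hxn hnorm
  have hcomm := (Finite.isDomain_to_isField
    (Subring.closure (insert x (Set.range P.subtype)))).mul_comm
    ⟨a, Subring.subset_closure (Set.mem_insert_of_mem _ ⟨⟨a, haP⟩, rfl⟩)⟩
    ⟨x, Subring.subset_closure (Set.mem_insert _ _)⟩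
  have hcomm' : a * x = x * a := congrArg Subtype.val hcomm
  rw [hcomm', sub_self] at hlx
  rcases mul_eq_zero.mp hlx.symm with h0 | h0
  · exact hl (Subtype.ext h0)
  · exact hx h0

/-- **Jacobson's commutativity theorem** for unital rings. -/
theorem Ring.mul_comm_of_potent {R : Type*} [Ring R]
    (h : ∀ x : R, ∃ n : ℕ, 1 < n ∧ x ^ n = x) (x y : R) : x * y = y * x := by
  have hred : ∀ z : R, z * z = 0 → z = 0 := by
    intro z hz
    obtain ⟨n, hn, hzn⟩ := h z
    obtain ⟨k, rfl⟩ := Nat.exists_eq_add_of_le hn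
    rw [← hzn, pow_add, Nat.succ_eq_add_one, pow_two, hz, zero_mul]
  have hcentral : ∀ e : R, e * e = e → ∀ z, e * z = z * e := fun e he =>
    mul_comm_of_idempotent_of_sq_zero he fun z hz => by simp [hred z hz]
  have hidem : ∀ c : R, ∃ k : ℕ, c ^ (k + 1) * c = c ∧
      c ^ (k + 1) * c ^ (k + 1) = c ^ (k + 1) := by
    intro c
    obtain ⟨n, hn, hc⟩ := h c
    obtain ⟨k, rfl⟩ := Nat.exists_eq_add_of_le hn
    have h1 : c ^ (k + 1) * c = c := by
      rw [← pow_succ]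
      convert hc using 2
      omega
    refine ⟨k, h1, ?_⟩
    nth_rewrite 2 [pow_succ']
    rw [← mul_assoc, h1, pow_succ']
  by_contra hxy
  obtain ⟨k, hec, hee⟩ := hidem (x * y - y * x)
  set c := x * y - y * x with hc
  have hspan : Ideal.span {1 - c ^ (k + 1)} ≠ ⊤ := by
    intro htop
    obtain ⟨r, hr⟩ := Ideal.mem_span_singleton'.mp ((Ideal.eq_top_iff_one _).mp htop)
    have h0 : c = 0 := by
      calc c = r * (1 - c ^ (k + 1)) * c := by rw [hr, one_mul]
        _ = 0 := by rw [mul_assoc, sub_mul, one_mul, hec, sub_self, mul_zero]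
    exact hxy (sub_eq_zero.mp h0)
  obtain ⟨M, hM, hle⟩ := Ideal.exists_le_maximal _ hspan
  have : M.IsTwoSided := by
    refine ⟨fun {a} b ha => ?_⟩
    obtain ⟨j, hja, hjj⟩ := hidem a
    have : a * b = a * b * a ^ j * a := by
      rw [mul_assoc, ← pow_succ, ← hcentral _ hjj, ← mul_assoc, hja]
    rw [this]
    exact M.mul_mem_left _ ha
  have : Nontrivial (R ⧸ M) := Ideal.Quotient.nontrivial_iff.mpr hM.ne_top
  have : NoZeroDivisors (R ⧸ M) := by
    refine ⟨fun {a b} hab => ?_⟩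
    obtain ⟨a, rfl⟩ := Ideal.Quotient.mk_surjective a
    obtain ⟨b, rfl⟩ := Ideal.Quotient.mk_surjective b
    rw [← map_mul] at hab
    simp only [Ideal.Quotient.eq_zero_iff_mem] at hab ⊢
    by_contra! hcon
    have hlt : M < M ⊔ Ideal.span {a} := by
      refine lt_of_le_of_ne le_sup_left fun heq => hcon.1 ?_
      rw [heq]
      exact (le_sup_right : Ideal.span {a} ≤ _) (Ideal.mem_span_singleton_self a)
    have h1 : (1 : R) ∈ M ⊔ Ideal.span {a} := by
      rw [hM.1.2 _ hlt]; trivial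
    obtain ⟨m, hm, z, hz, hmz⟩ := Submodule.mem_sup.mp h1
    obtain ⟨r, rfl⟩ := Ideal.mem_span_singleton'.mp hz
    refine hcon.2 ?_
    rw [← one_mul b, ← hmz, add_mul, mul_assoc]
    exact add_mem (Ideal.IsTwoSided.mul_mem_of_left b hm) (M.mul_mem_left r hab)
  have : IsDomain (R ⧸ M) := NoZeroDivisors.to_isDomain _
  have hpot : ∀ q : R ⧸ M, ∃ n : ℕ, 1 < n ∧ q ^ n = q := by
    intro q
    obtain ⟨q, rfl⟩ := Ideal.Quotient.mk_surjective q
    obtain ⟨n, hn, hq⟩ := h q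
    exact ⟨n, hn, by rw [← map_pow, hq]⟩
  have hcM : c ∈ M := by
    rw [← Ideal.Quotient.eq_zero_iff_mem, hc, map_sub, map_mul, map_mul,
      IsDomain.mul_comm_of_potent hpot, sub_self]
  refine hM.ne_top ((Ideal.eq_top_iff_one _).mpr ?_)
  rw [← sub_add_cancel 1 (c ^ (k + 1))]
  refine add_mem (hle (Ideal.mem_span_singleton_self _)) ?_
  rw [pow_succ]
  exact M.mul_mem_left _ hcM

section nupow

variable {R : Type*} [NonUnitalRing R]

theorem nupow_succ (x : R) {n : ℕ} (hn : 0 < n) : nupow x (n + 1) = nupow x n * x := by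
  obtain ⟨k, rfl⟩ := Nat.exists_eq_add_of_lt hn
  rw [zero_add]
  rfl

theorem mul_nupow_of_mul_eq {e b : R} (h : e * b = b) {k : ℕ} (hk : 0 < k) :
    e * nupow b k = nupow b k := by
  induction k, hk using Nat.le_induction with
  | base => exact h
  | succ k hk ih => rw [nupow_succ b hk, ← mul_assoc, ih]

theorem nupow_mul_of_central {f : R} (hf : f * f = f) (hc : ∀ x, f * x = x * f) (b : R) {k : ℕ}
    (hk : 0 < k) : nupow (f * b) k = f * nupow b k := by
  induction k, hk using Nat.le_induction with
  | base => rfl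
  | succ k hk ih =>
    rw [nupow_succ _ hk, nupow_succ _ hk, ih, mul_assoc, ← mul_assoc _ f b, ← hc, ← mul_assoc,
      ← mul_assoc, hf, mul_assoc]

theorem coe_corner_pow {f : R} (hf : IsIdempotentElem f) (x : hf.Corner) {k : ℕ} (hk : 0 < k) :
    ((x ^ k : hf.Corner).1 : R) = nupow x.1 k := by
  induction k, hk using Nat.le_induction with
  | base => exact congrArg Subtype.val (pow_one x)
  | succ k hk ih => rw [pow_succ, nupow_succ _ hk, ← ih]; rfl

/-- Adding an element that annihilates the ring does not change higher powers. -/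
theorem nupow_add_of_annihilates {a : R} (ha : ∀ x, x * a = 0 ∧ a * x = 0) (b : R) {k : ℕ}
    (hk : 1 < k) : nupow (a + b) k = nupow b k := by
  induction k, hk using Nat.le_induction with
  | base =>
    change (a + b) * (a + b) = b * b
    rw [add_mul, (ha _).2, mul_add, (ha _).1, zero_add, zero_add]
  | succ k hk ih =>
    rw [nupow_succ _ (by omega), nupow_succ _ (by omega), ih, mul_add, (ha _).1, zero_add]

end nupow

/-- A weakly periodic ring which annihilates its nilpotent elements on both sides
(`x * r = 0 = r * x` for every `x ∈ R` and every nilpotent `r`) is a commutative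
periodic ring. -/
theorem stmt11 {R : Type*} [NonUnitalRing R]
    (hwp : ∀ x : R, ∃ a b : R, x = a + b ∧ (∃ k : ℕ, 0 < k ∧ nupow a k = 0) ∧
      (∃ m : ℕ, 1 < m ∧ nupow b m = b))
    (hann : ∀ x r : R, (∃ k : ℕ, 0 < k ∧ nupow r k = 0) → x * r = 0 ∧ r * x = 0) :
    (∀ x y : R, x * y = y * x) ∧
    (∀ x : R, ∃ m n : ℕ, 0 < m ∧ 0 < n ∧ nupow x (m + n) = nupow x m) := by
  have hsplit : ∀ x : R, ∃ a b : R, x = a + b ∧ (∀ y, y * a = 0 ∧ a * y = 0) ∧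
      ∃ m : ℕ, 1 < m ∧ nupow b m = b := by
    intro x
    obtain ⟨a, b, hab, ha, hb⟩ := hwp x
    exact ⟨a, b, hab, fun y => hann y a ha, hb⟩
  have hcentral : ∀ e : R, e * e = e → ∀ x, e * x = x * e := fun e he =>
    mul_comm_of_idempotent_of_sq_zero he fun z hz => hann e z ⟨2, two_pos, hz⟩
  have hidem : ∀ b : R, (∃ m : ℕ, 1 < m ∧ nupow b m = b) → ∃ e : R, e * e = e ∧ e * b = b := by
    rintro b ⟨m, hm, hb⟩
    obtain ⟨k, rfl⟩ := Nat.exists_eq_add_of_lt hm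
    have heb : nupow b (1 + k) * b = b := by rw [← nupow_succ _ (by omega), hb]
    exact ⟨_, mul_nupow_of_mul_eq heb (by omega), heb⟩
  have hcorner : ∀ f : R, f * f = f → ∀ x y : R, f * (x * y) = f * (y * x) := by
    intro f hf x y
    have hf' : IsIdempotentElem f := hf
    have hpot : ∀ z : hf'.Corner, ∃ n : ℕ, 1 < n ∧ z ^ n = z := by
      rintro ⟨_, z, rfl⟩
      obtain ⟨a, b, rfl, ha, m, hm, hb⟩ := hsplit z
      refine ⟨m, hm, Subtype.ext ?_⟩
      refine (coe_corner_pow hf' _ (by omega)).trans ?_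
      have : f * (a + b) * f = f * b := by
        rw [mul_add, (ha f).1, zero_add, mul_assoc, ← hcentral f hf, ← mul_assoc, hf]
      change nupow (f * (a + b) * f) m = f * (a + b) * f
      rw [this, nupow_mul_of_central hf (hcentral f hf) _ (by omega), hb]
    have hmul : f * x * f * (f * y * f) = f * y * f * (f * x * f) := congrArg Subtype.val
      (Ring.mul_comm_of_potent hpot ⟨f * x * f, x, rfl⟩ ⟨f * y * f, y, rfl⟩)
    have hexp : ∀ u v : R, f * u * f * (f * v * f) = f * (u * v) := by
      intro u v
      rw [← hcentral f hf (f * v), ← hcentral f hf (f * u), ← mul_assoc f f, ← mul_assoc f f, hf,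
        hcentral f hf u, mul_assoc, ← mul_assoc f f, hf, ← mul_assoc, ← hcentral f hf u, mul_assoc]
    rwa [hexp, hexp] at hmul
  refine ⟨fun x y => ?_, fun x => ?_⟩
  · obtain ⟨a, b, rfl, ha, hb⟩ := hsplit x
    obtain ⟨e, hee, heb⟩ := hidem b hb
    rw [add_mul, mul_add, (ha y).1, (ha y).2, zero_add, zero_add]
    have h1 : b * y = e * (b * y) := by rw [← mul_assoc, heb]
    have h2 : y * b = e * (y * b) := by
      rw [← mul_assoc, hcentral e hee y, mul_assoc, heb]
    rw [h1, h2, hcorner e hee]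
  · obtain ⟨a, b, rfl, ha, m, hm, hb⟩ := hsplit x
    refine ⟨2, m - 1, two_pos, by omega, ?_⟩
    rw [nupow_add_of_annihilates ha _ (by omega), nupow_add_of_annihilates ha _ (by omega),
      show 2 + (m - 1) = m + 1 by omega, nupow_succ _ (by omega), hb]
    rfl
end
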